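/- arXiv:0910.0376 — 8 statements merged into one kernel-verified Lean document; each statement's English description precedes it below -/
import Mathlib

section
/- Let n ≥ 1 and let T : Fin n → Fin n → Fin n → ℝ be totally symmetric, i.e. T i j k = T j i k = T i k j for all indices (so T is invariant under all permutations of its three indices). Then Σ_{i,j,k} (T i j k)² ≥ (3/(n+2)) · Σ_i (Σ_j T i j j)². -/
/-- The symmetrization of `δ ⊗ H`, where `δ` is the Kronecker delta. -/
def symmDelta {ι : Type*} [DecidableEq ι] (H : ι → ℝ) (i j k : ι) : ℝ :=
  (if i = j then H k else 0) + (if j = k then H i else 0) + (if i = k then H j else 0)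

theorem symmDelta_swap_left {ι : Type*} [DecidableEq ι] (H : ι → ℝ) (i j k : ι) :
    symmDelta H i j k = symmDelta H j i k := by
  simp only [symmDelta, eq_comm (a := j) (b := i)]
  ring

theorem symmDelta_swap_right {ι : Type*} [DecidableEq ι] (H : ι → ℝ) (i j k : ι) :
    symmDelta H i j k = symmDelta H i k j := by
  simp only [symmDelta, eq_comm (a := k) (b := j)]
  ring

theorem sum_symmDelta_trace {ι : Type*} [Fintype ι] [DecidableEq ι] (H : ι → ℝ) (i : ι) :
    ∑ j, symmDelta H i j j = (Fintype.card ι + 2) * H i := by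
  simp only [symmDelta, if_true, Finset.sum_add_distrib, Finset.sum_ite_eq, Finset.mem_univ,
    Finset.sum_const, Finset.card_univ, nsmul_eq_mul]
  ring

/-- Pairing a totally symmetric tensor with `symmDelta H` only sees its trace. -/
theorem sum_mul_symmDelta {ι : Type*} [Fintype ι] [DecidableEq ι] (T : ι → ι → ι → ℝ)
    (hleft : ∀ i j k, T i j k = T j i k) (hright : ∀ i j k, T i j k = T i k j) (H : ι → ℝ) :
    ∑ i, ∑ j, ∑ k, T i j k * symmDelta H i j k = 3 * ∑ i, (∑ j, T i j j) * H i := by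
  have h₁ : ∑ i, ∑ j, ∑ k, T i j k * (if i = j then H k else 0) =
      ∑ i, (∑ j, T i j j) * H i := by
    have h (i : ι) : ∑ j, ∑ k, T i j k * (if i = j then H k else 0) =
        ∑ k, T k i i * H k := by
      rw [Finset.sum_comm]
      refine Finset.sum_congr rfl fun k _ => ?_
      simp [hright i i k, hleft i k i]
    simp only [h, Finset.sum_mul]
    exact Finset.sum_comm
  have h₂ : ∑ i, ∑ j, ∑ k, T i j k * (if j = k then H i else 0) =
      ∑ i, (∑ j, T i j j) * H i := by
    simp [Finset.sum_mul]
  have h₃ : ∑ i, ∑ j, ∑ k, T i j k * (if i = k then H j else 0) =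
      ∑ i, (∑ j, T i j j) * H i := by
    rw [← h₁]
    refine Finset.sum_congr rfl fun i _ => ?_
    rw [Finset.sum_comm]
    simp only [hright i]
  simp only [symmDelta, mul_add, Finset.sum_add_distrib, h₁, h₂, h₃]
  ring

/-- Algebraic content of Lemma 2.4 (Huisken): for a totally symmetric 3-tensor `T`,
`‖T‖² ≥ 3/(n+2) · ‖tr T‖²`. -/
theorem stmt_0 (n : ℕ) (hn : 1 ≤ n) (T : Fin n → Fin n → Fin n → ℝ)
    (hsymm₁ : ∀ i j k, T i j k = T j i k)
    (hsymm₂ : ∀ i j k, T i j k = T i k j) :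
    ∑ i, ∑ j, ∑ k, (T i j k) ^ 2 ≥
      (3 / (n + 2)) * ∑ i, (∑ j, T i j j) ^ 2 := by
  set H : Fin n → ℝ := fun i => ∑ j, T i j j with hH
  set c : ℝ := 1 / (n + 2) with hc
  have hTS : ∑ i, ∑ j, ∑ k, T i j k * symmDelta H i j k = 3 * ∑ i, H i ^ 2 := by
    simp only [sum_mul_symmDelta T hsymm₁ hsymm₂, sq, hH]
  have hSS : ∑ i, ∑ j, ∑ k, symmDelta H i j k * symmDelta H i j k =
      3 * ((n + 2) * ∑ i, H i ^ 2) := by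
    rw [sum_mul_symmDelta _ (symmDelta_swap_left H) (symmDelta_swap_right H)]
    simp only [sum_symmDelta_trace, Fintype.card_fin, mul_assoc, Finset.mul_sum, sq]
  have hnonneg : 0 ≤ ∑ i, ∑ j, ∑ k, (T i j k - c * symmDelta H i j k) ^ 2 := by positivity
  have hexpand : ∑ i, ∑ j, ∑ k, (T i j k - c * symmDelta H i j k) ^ 2 =
      ∑ i, ∑ j, ∑ k, T i j k ^ 2 - 2 * c * ∑ i, ∑ j, ∑ k, T i j k * symmDelta H i j k +
        c ^ 2 * ∑ i, ∑ j, ∑ k, symmDelta H i j k * symmDelta H i j k := by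
    simp only [Finset.mul_sum, ← Finset.sum_sub_distrib, ← Finset.sum_add_distrib]
    refine Finset.sum_congr rfl fun i _ => Finset.sum_congr rfl fun j _ =>
      Finset.sum_congr rfl fun k _ => ?_
    ring
  rw [hexpand, hTS, hSS] at hnonneg
  have hcoeff : 2 * c * (3 * ∑ i, H i ^ 2) - c ^ 2 * (3 * ((n + 2) * ∑ i, H i ^ 2)) =
      3 / (n + 2) * ∑ i, H i ^ 2 := by
    rw [hc]
    field_simp
    ring
  change 3 / (n + 2) * ∑ i, H i ^ 2 ≤ _
  linarith
end

section
/- Let n ≥ 1 and let T : Fin n → Fin n → Fin n → ℝ be totally symmetric, i.e. T i j k = T j i k = T i k j for all indices. Define H i = Σ_j T i j j. Then Σ_{i,j,k} (T i j k − (1/n)·(if j = k then H i else 0))² ≥ (2(n−1)/(3n)) · Σ_{i,j,k} (T i j k)². -/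
open Finset in
/-- The squared norm of a totally symmetric 3-tensor controls that of its trace. -/
theorem trace_sq_le_of_symmetric (n : ℕ) (T : Fin n → Fin n → Fin n → ℝ)
    (hsymm₁ : ∀ i j k, T i j k = T j i k)
    (hsymm₂ : ∀ i j k, T i j k = T i k j)
    (H : Fin n → ℝ) (hH : ∀ i, H i = ∑ j, T i j j) :
    3 * ∑ i, H i ^ 2 ≤ (n + 2) * ∑ i, ∑ j, ∑ k, (T i j k) ^ 2 := by
  have hT₁ : ∑ i, ∑ j, ∑ k, T i j k * (if j = k then H i else 0) = ∑ i, H i ^ 2 := by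
    simp [← sum_mul, ← hH, sq]
  have hT₂ : ∑ i, ∑ j, ∑ k, T i j k * (if i = k then H j else 0) = ∑ i, H i ^ 2 := by
    rw [sum_comm, ← hT₁]
    simp only [hsymm₁]
  have hT₃ : ∑ i, ∑ j, ∑ k, T i j k * (if i = j then H k else 0) = ∑ i, H i ^ 2 := by
    rw [← hT₂]
    refine sum_congr rfl fun i _ => ?_
    rw [sum_comm]
    exact sum_congr rfl fun j _ => sum_congr rfl fun k _ => by rw [hsymm₂]
  have h₁₁ : ∑ i : Fin n, ∑ j : Fin n, ∑ k : Fin n, (if j = k then H i else 0) ^ 2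
      = n * ∑ i, H i ^ 2 := by
    simp [ite_pow, mul_sum]
  have h₂₂ : ∑ i : Fin n, ∑ j : Fin n, ∑ k : Fin n, (if i = k then H j else 0) ^ 2
      = n * ∑ i, H i ^ 2 := by
    simp [ite_pow]
  have h₃₃ : ∑ i : Fin n, ∑ j : Fin n, ∑ k : Fin n, (if i = j then H k else 0) ^ 2
      = n * ∑ i, H i ^ 2 := by
    rw [← h₂₂]
    exact sum_congr rfl fun i _ => sum_comm
  have h₁₂ : ∑ i : Fin n, ∑ j : Fin n, ∑ k : Fin n,
      (if j = k then H i else 0) * (if i = k then H j else 0) = ∑ i, H i ^ 2 := by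
    simp [sq]
  have h₁₃ : ∑ i : Fin n, ∑ j : Fin n, ∑ k : Fin n,
      (if j = k then H i else 0) * (if i = j then H k else 0) = ∑ i, H i ^ 2 := by
    simp [sq]
  have h₂₃ : ∑ i : Fin n, ∑ j : Fin n, ∑ k : Fin n,
      (if i = k then H j else 0) * (if i = j then H k else 0) = ∑ i, H i ^ 2 := by
    simp [sq]
  have hpos : 0 ≤ ∑ i, ∑ j, ∑ k, ((n + 2) * T i j k - ((if j = k then H i else 0)
      + (if i = k then H j else 0) + (if i = j then H k else 0))) ^ 2 :=
    sum_nonneg fun _ _ => sum_nonneg fun _ _ => sum_nonneg fun _ _ => sq_nonneg _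
  have hexp (t a b c : ℝ) : ((n + 2) * t - (a + b + c)) ^ 2 = (n + 2) ^ 2 * t ^ 2
      - 2 * (n + 2) * (t * a) - 2 * (n + 2) * (t * b) - 2 * (n + 2) * (t * c)
      + a ^ 2 + b ^ 2 + c ^ 2 + 2 * (a * b) + 2 * (a * c) + 2 * (b * c) := by ring
  simp only [hexp, sum_add_distrib, sum_sub_distrib, ← mul_sum] at hpos
  rw [hT₁, hT₂, hT₃, h₁₁, h₂₂, h₃₃, h₁₂, h₁₃, h₂₃] at hpos
  have hn : (0 : ℝ) < n + 2 := by positivity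
  refine le_of_mul_le_mul_left ?_ hn
  linarith

/-- Algebraic content of the second inequality of Lemma 2.4 (Huisken): for a totally
symmetric 3-tensor `T` with trace `H i = ∑ j, T i j j`, one has
`‖T - (1/n) g ⊗ H‖² ≥ 2(n-1)/(3n) · ‖T‖²`. -/
theorem stmt_1 (n : ℕ) (hn : 1 ≤ n) (T : Fin n → Fin n → Fin n → ℝ)
    (hsymm₁ : ∀ i j k, T i j k = T j i k)
    (hsymm₂ : ∀ i j k, T i j k = T i k j)
    (H : Fin n → ℝ) (hH : ∀ i, H i = ∑ j, T i j j) :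
    ∑ i, ∑ j, ∑ k, (T i j k - (1 / n) * (if j = k then H i else 0)) ^ 2 ≥
      (2 * (n - 1) / (3 * n)) * ∑ i, ∑ j, ∑ k, (T i j k) ^ 2 := by
  have hn₀ : (0 : ℝ) < n := by exact_mod_cast hn
  have hT : ∑ i, ∑ j, ∑ k, T i j k * (if j = k then H i else 0) = ∑ i, H i ^ 2 := by
    simp [← Finset.sum_mul, ← hH, sq]
  have hD : ∑ i : Fin n, ∑ j : Fin n, ∑ k : Fin n, (if j = k then H i else 0) ^ 2
      = n * ∑ i, H i ^ 2 := by
    simp [ite_pow, Finset.mul_sum]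
  have hexp (t a : ℝ) : (t - 1 / n * a) ^ 2
      = t ^ 2 - 2 / n * (t * a) + (1 / n) ^ 2 * a ^ 2 := by ring
  simp only [hexp, Finset.sum_add_distrib, Finset.sum_sub_distrib, ← Finset.mul_sum]
  rw [hT, hD]
  have key := trace_sq_le_of_symmetric n T hsymm₁ hsymm₂ H hH
  rw [ge_iff_le, ← sub_nonneg]
  generalize ∑ i, ∑ j, ∑ k, T i j k ^ 2 = S at *
  generalize ∑ i, H i ^ 2 = Q at *
  have : S - 2 / n * Q + (1 / n) ^ 2 * (n * Q) - 2 * (n - 1) / (3 * n) * S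
      = ((n + 2) * S - 3 * Q) / (3 * n) := by
    field_simp
    ring
  rw [this]
  exact div_nonneg (sub_nonneg.2 key) (by positivity)
end

section
/- Let n ≥ 2 and let κ : Fin n → ℝ with H := Σᵢ κᵢ > 0. Suppose 0 ≤ ε < 1/(n(n−1)) and Σᵢ κᵢ² − H²/n ≤ ε·H². Then every κᵢ is strictly positive, and for each i: (1 − √(n(n−1)ε))·H/n ≤ κᵢ ≤ (1 + √(n(n−1)ε))·H/n. -/
/-- The deviation of one value from the mean of a finite family is controlled by the variance
of the family, with the sharp constant. -/
lemma sq_card_mul_sub_sum_le {n : ℕ} (hn : 1 ≤ n) (κ : Fin n → ℝ) (i : Fin n) :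
    (n * κ i - ∑ j, κ j) ^ 2 ≤ n * (n - 1) * (∑ j, κ j ^ 2 - (∑ j, κ j) ^ 2 / n) := by
  have hn0 : (0 : ℝ) < n := by exact_mod_cast hn
  have hcs := sq_sum_le_card_mul_sum_sq (s := Finset.univ.erase i) (f := κ)
  have hsum := Finset.add_sum_erase Finset.univ κ (Finset.mem_univ i)
  have hsq := Finset.add_sum_erase Finset.univ (fun j => κ j ^ 2) (Finset.mem_univ i)
  rw [Finset.card_erase_of_mem (Finset.mem_univ i), Finset.card_univ, Fintype.card_fin,
    Nat.cast_sub hn, Nat.cast_one, eq_sub_of_add_eq' hsum, eq_sub_of_add_eq' hsq] at hcs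
  have hrhs : (n : ℝ) * (n - 1) * (∑ j, κ j ^ 2 - (∑ j, κ j) ^ 2 / n) =
      n * (n - 1) * ∑ j, κ j ^ 2 - (n - 1) * (∑ j, κ j) ^ 2 := by
    field_simp
  rw [hrhs]
  nlinarith [mul_le_mul_of_nonneg_left hcs hn0.le]

/-- Lemma 2.5 of the paper: if `H > 0` and `‖Å‖² ≤ ε H²` with `ε < 1/(n(n-1))`, then all
principal curvatures are positive and pinched around `H/n`. -/
theorem stmt_2 (n : ℕ) (hn : 2 ≤ n) (κ : Fin n → ℝ) (ε : ℝ)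
    (hH : 0 < ∑ i, κ i)
    (hε0 : 0 ≤ ε) (hε1 : ε < 1 / (n * (n - 1)))
    (hpinch : ∑ i, (κ i) ^ 2 - (∑ i, κ i) ^ 2 / n ≤ ε * (∑ i, κ i) ^ 2) :
    (∀ i, 0 < κ i) ∧
      (∀ i, (1 - Real.sqrt (n * (n - 1) * ε)) * (∑ i, κ i) / n ≤ κ i ∧
        κ i ≤ (1 + Real.sqrt (n * (n - 1) * ε)) * (∑ i, κ i) / n) := by
  have hn2 : (2 : ℝ) ≤ n := by exact_mod_cast hn
  have hn0 : (0 : ℝ) < n := by linarith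
  have hc : (0 : ℝ) < n * (n - 1) := mul_pos hn0 (by linarith)
  have hsqrt : Real.sqrt (n * (n - 1) * ε) < 1 := by
    rw [Real.sqrt_lt' one_pos, one_pow, mul_comm]
    exact (lt_div_iff₀ hc).1 hε1
  have hbound : ∀ i, (1 - Real.sqrt (n * (n - 1) * ε)) * (∑ i, κ i) / n ≤ κ i ∧
      κ i ≤ (1 + Real.sqrt (n * (n - 1) * ε)) * (∑ i, κ i) / n := by
    intro i
    have hdev : (n * κ i - ∑ j, κ j) ^ 2 ≤
        (Real.sqrt (n * (n - 1) * ε) * ∑ j, κ j) ^ 2 := by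
      rw [mul_pow, Real.sq_sqrt (mul_nonneg hc.le hε0), mul_assoc]
      exact (sq_card_mul_sub_sum_le (by omega) κ i).trans
        (mul_le_mul_of_nonneg_left hpinch hc.le)
    obtain ⟨hlow, hupp⟩ := abs_le_of_sq_le_sq' hdev (mul_nonneg (Real.sqrt_nonneg _) hH.le)
    rw [div_le_iff₀ hn0, le_div_iff₀ hn0]
    constructor <;> linarith
  exact ⟨fun i => (div_pos (mul_pos (sub_pos.2 hsqrt) hH) hn0).trans_le (hbound i).1, hbound⟩
end

section
/- Let n ≥ 2 and let κ : Fin n → ℝ with H := Σᵢ κᵢ > 0. Suppose 0 < ε < 1/(n(n−1)) and Σᵢ κᵢ² − H²/n = ε·H². Let C := Σᵢ κᵢ³ and ‖A‖² := Σᵢ κᵢ². Then n·C − (1 + nε)·H·‖A‖² ≥ ε·(1 + nε)·(1 − √(n(n−1)ε))·H³. -/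
open Finset in
/-- A coordinate of a vector with zero sum is bounded by the Euclidean norm. -/
theorem card_mul_sq_le_of_sum_eq_zero {ι : Type*} [Fintype ι] {x : ι → ℝ}
    (hx : ∑ i, x i = 0) (i : ι) :
    (Fintype.card ι : ℝ) * x i ^ 2 ≤ ((Fintype.card ι : ℝ) - 1) * ∑ j, x j ^ 2 := by
  classical
  have hcs := sq_sum_le_card_mul_sum_sq (s := univ.erase i) (f := x)
  have hsum := add_sum_erase univ x (mem_univ i)
  have hsq := add_sum_erase univ (fun j => x j ^ 2) (mem_univ i)
  have hcard : ((univ.erase i).card : ℝ) = (Fintype.card ι : ℝ) - 1 := by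
    rw [cast_card_erase_of_mem (mem_univ i), card_univ]
  rw [hcard, show ∑ j ∈ univ.erase i, x j = -x i by linarith,
    show ∑ j ∈ univ.erase i, x j ^ 2 = ∑ j, x j ^ 2 - x i ^ 2 by linarith] at hcs
  linarith

/-- The lower bound of Okumura for the sum of cubes of a vector with zero sum. -/
theorem neg_le_sum_cube_of_sum_eq_zero {ι : Type*} [Fintype ι] {x : ι → ℝ} {a : ℝ}
    (hcard : 2 ≤ Fintype.card ι) (ha : 0 ≤ a) (hx : ∑ i, x i = 0)
    (hsq : ((Fintype.card ι : ℝ) - 1) * ∑ i, x i ^ 2 = Fintype.card ι * a ^ 2) :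
    -((Fintype.card ι : ℝ) * (Fintype.card ι - 2) * a ^ 3) ≤
      ((Fintype.card ι : ℝ) - 1) ^ 2 * ∑ i, x i ^ 3 := by
  have hn : (2 : ℝ) ≤ Fintype.card ι := by exact_mod_cast hcard
  set n := (Fintype.card ι : ℝ) with hndef
  have hlow (i : ι) : 0 ≤ x i + a := by
    have h := card_mul_sq_le_of_sum_eq_zero hx i
    rw [← hndef, hsq] at h
    have h' : x i ^ 2 ≤ a ^ 2 := le_of_mul_le_mul_left h (by linarith)
    linarith [neg_le_of_abs_le (abs_le_of_sq_le_sq h' ha)]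
  have hpos : 0 ≤ ∑ i, (x i + a) * ((n - 1) * x i - a) ^ 2 :=
    Finset.sum_nonneg fun i _ => mul_nonneg (hlow i) (sq_nonneg _)
  have hexp : ∑ i, (x i + a) * ((n - 1) * x i - a) ^ 2 =
      (n - 1) ^ 2 * ∑ i, x i ^ 3 + (n - 3) * (n - 1) * a * ∑ i, x i ^ 2 +
        (a ^ 2 - 2 * (n - 1) * a ^ 2) * ∑ i, x i + n * a ^ 3 := by
    have hconst : n * a ^ 3 = ∑ _i : ι, a ^ 3 := by simp [hndef]
    rw [hconst]
    simp only [Finset.mul_sum, ← Finset.sum_add_distrib]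
    exact Finset.sum_congr rfl fun i _ => by ring
  rw [hexp, hx] at hpos
  linear_combination hpos + (n - 3) * a * hsq


/-- Lemma 2.6 of the paper: if `H > 0` and `‖Å‖² = ε H²` with `0 < ε < 1/(n(n-1))`, then
`n C - (1 + nε) H ‖A‖² ≥ ε (1 + nε)(1 - √(n(n-1)ε)) H³`, where `C = ∑ κᵢ³` and
`‖A‖² = ∑ κᵢ²`. -/
theorem stmt_3 (n : ℕ) (hn : 2 ≤ n) (κ : Fin n → ℝ) (ε : ℝ)
    (hH : 0 < ∑ i, κ i)
    (hε0 : 0 < ε) (hε1 : ε < 1 / (n * (n - 1)))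
    (hpinch : ∑ i, (κ i) ^ 2 - (∑ i, κ i) ^ 2 / n = ε * (∑ i, κ i) ^ 2) :
    n * (∑ i, (κ i) ^ 3) - (1 + n * ε) * (∑ i, κ i) * (∑ i, (κ i) ^ 2) ≥
      ε * (1 + n * ε) * (1 - Real.sqrt (n * (n - 1) * ε)) * (∑ i, κ i) ^ 3 := by

  have hn' : (2 : ℝ) ≤ n := by exact_mod_cast hn
  have hn0 : (n : ℝ) ≠ 0 := by linarith
  have hn1 : 0 < (n : ℝ) - 1 := by linarith
  set H := ∑ i, κ i with hHdef
  have hs2 : Real.sqrt (n * (n - 1) * ε) ^ 2 = n * (n - 1) * ε := Real.sq_sqrt (by positivity)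
  have hs0 : 0 ≤ Real.sqrt (n * (n - 1) * ε) := Real.sqrt_nonneg _
  set s := Real.sqrt (n * (n - 1) * ε)
  obtain ⟨m, hm⟩ : ∃ m, m = H / n := ⟨_, rfl⟩
  have hHm : H = n * m := by rw [hm]; field_simp
  have hm0 : 0 < m := by rw [hm]; positivity
  have hconst (c : ℝ) : ∑ _i : Fin n, c = n * c := by simp
  have hx : ∑ i, (κ i - m) = 0 := by
    rw [Finset.sum_sub_distrib, hconst, ← hHdef, hHm, sub_self]
  have hκ2 : ∑ i, κ i ^ 2 = ε * (n * m) ^ 2 + n * m ^ 2 := by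
    rw [hHm] at hpinch
    have : ((n : ℝ) * m) ^ 2 / n = n * m ^ 2 := by field_simp
    linarith
  have hx2 : ∑ i, (κ i - m) ^ 2 = ε * (n * m) ^ 2 := by
    have : ∑ i, (κ i - m) ^ 2 = ∑ i, κ i ^ 2 - 2 * m * H + n * m ^ 2 := by
      rw [hHdef, ← hconst, Finset.mul_sum, ← Finset.sum_sub_distrib, ← Finset.sum_add_distrib]
      exact Finset.sum_congr rfl fun i _ => by ring
    rw [this, hκ2, hHm]; ring
  have hκ3 : ∑ i, κ i ^ 3 = ∑ i, (κ i - m) ^ 3 + 3 * m * ∑ i, (κ i - m) ^ 2 + n * m ^ 3 := by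
    have : ∑ i, κ i ^ 3 = ∑ i, (κ i - m) ^ 3 + 3 * m * ∑ i, (κ i - m) ^ 2 +
        3 * m ^ 2 * ∑ i, (κ i - m) + n * m ^ 3 := by
      rw [← hconst]
      simp only [Finset.mul_sum, ← Finset.sum_add_distrib]
      exact Finset.sum_congr rfl fun i _ => by ring
    rw [this, hx]; ring
  have hT := neg_le_sum_cube_of_sum_eq_zero (a := s * m) (by simpa using hn) (by positivity) hx
    (by rw [hx2, Fintype.card_fin]; linear_combination -(n : ℝ) * m ^ 2 * hs2)
  rw [Fintype.card_fin] at hT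
  have hε : ε = s ^ 2 / (n * (n - 1)) := by rw [hs2]; field_simp
  have hkey : 0 ≤ s ^ 3 * (1 - s) ^ 2 * m ^ 3 := by positivity
  rw [hκ3, hx2, hκ2, hHm, ge_iff_le]
  refine le_of_mul_le_mul_left ?_ (pow_pos hn1 2)
  clear_value s
  subst hε
  have hne : (n : ℝ) - 1 ≠ 0 := hn1.ne'
  field_simp
  nlinarith [hT, hkey]
end

section
/- Let n ≥ 2, let 1 ≤ k < ℓ ≤ n, and let C₁ : ℝ → ℝ be a function with C₁(ε) ≥ 0 for each ε > 0. Then for every ε' > 0 there exists a constant C' ≥ 0 such that: for every κ : Fin n → ℝ with κᵢ > 0 for all i and satisfying maxᵢ κᵢ ≤ (1+ε)·minᵢ κᵢ + C₁(ε) for every ε > 0, one has E_k(κ) ≤ (1+ε')·E_ℓ(κ)^{k/ℓ} + C', where the power is a real power. -/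
/-- The normalized `m`-th elementary symmetric function of `κ : Fin n → ℝ`:
`E_m(κ) = (1/binom(n,m)) ∑_{i₁<…<i_m} κ_{i₁}⋯κ_{i_m}`. -/
noncomputable def normEsymm (n m : ℕ) (κ : Fin n → ℝ) : ℝ :=
  (1 / (n.choose m : ℝ)) * ∑ t ∈ Finset.univ.powersetCard m, ∏ i ∈ t, κ i

theorem normEsymm_le_pow {n m : ℕ} (hm : m ≤ n) {κ : Fin n → ℝ} {b : ℝ}
    (hκ : ∀ i, 0 ≤ κ i) (hb : ∀ i, κ i ≤ b) : normEsymm n m κ ≤ b ^ m := by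
  have hc : (0 : ℝ) < n.choose m := by exact_mod_cast Nat.choose_pos hm
  have h := Finset.sum_le_card_nsmul (Finset.univ.powersetCard m) (fun t => ∏ i ∈ t, κ i) (b ^ m)
    fun t ht => by
      rw [← (Finset.mem_powersetCard.mp ht).2, ← Finset.prod_const]
      exact Finset.prod_le_prod (fun i _ => hκ i) fun i _ => hb i
  rw [Finset.card_powersetCard, Finset.card_fin, nsmul_eq_mul] at h
  rw [normEsymm, one_div_mul_eq_div, div_le_iff₀' hc]
  exact h

theorem pow_le_normEsymm {n m : ℕ} (hm : m ≤ n) {κ : Fin n → ℝ} {a : ℝ}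
    (ha : 0 ≤ a) (hκ : ∀ i, a ≤ κ i) : a ^ m ≤ normEsymm n m κ := by
  have hc : (0 : ℝ) < n.choose m := by exact_mod_cast Nat.choose_pos hm
  have h := Finset.card_nsmul_le_sum (Finset.univ.powersetCard m) (fun t => ∏ i ∈ t, κ i) (a ^ m)
    fun t ht => by
      rw [← (Finset.mem_powersetCard.mp ht).2, ← Finset.prod_const]
      exact Finset.prod_le_prod (fun _ _ => ha) fun i _ => hκ i
  rw [Finset.card_powersetCard, Finset.card_fin, nsmul_eq_mul] at h
  rw [normEsymm, one_div_mul_eq_div, le_div_iff₀' hc]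
  exact h

/-- A lower bound on the variables bounds `E_ℓ ^ (k / ℓ)` below by the `k`-th power. -/
theorem pow_le_normEsymm_rpow {n k ℓ : ℕ} (hℓ : ℓ ≠ 0) (hln : ℓ ≤ n) {κ : Fin n → ℝ} {a : ℝ}
    (ha : 0 ≤ a) (hκ : ∀ i, a ≤ κ i) : a ^ k ≤ normEsymm n ℓ κ ^ ((k : ℝ) / ℓ) := by
  have hℓ' : (ℓ : ℝ) ≠ 0 := Nat.cast_ne_zero.mpr hℓ
  calc a ^ k = (a ^ ℓ) ^ ((k : ℝ) / ℓ) := by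
        rw [← Real.rpow_natCast_mul ha, mul_div_cancel₀ _ hℓ', Real.rpow_natCast]
    _ ≤ normEsymm n ℓ κ ^ ((k : ℝ) / ℓ) := by
        gcongr
        exact pow_le_normEsymm hln ha hκ

/-- Affine bounds of slope `1 + ε` give bounds of `k`-th powers with factor `(1 + 2 * ε) ^ k`. -/
theorem affine_pow_le {ε a c : ℝ} (k : ℕ) (hε : 0 < ε) (ha : 0 ≤ a) (hc : 0 ≤ c) :
    ((1 + ε) * a + c) ^ k ≤ (1 + 2 * ε) ^ k * a ^ k + ((1 + ε) * (c / ε) + c) ^ k := by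
  rcases le_total c (ε * a) with h | h
  · rw [← mul_pow]
    have : ((1 + ε) * a + c) ^ k ≤ ((1 + 2 * ε) * a) ^ k := by
      gcongr
      linarith
    have : 0 ≤ ((1 + ε) * (c / ε) + c) ^ k := by positivity
    linarith
  · have : a ≤ c / ε := (le_div_iff₀' hε).mpr h
    have : ((1 + ε) * a + c) ^ k ≤ ((1 + ε) * (c / ε) + c) ^ k := by gcongr
    have : 0 ≤ (1 + 2 * ε) ^ k * a ^ k := by positivity
    linarith

/-- Inequality (3.1) in the proof of Theorem 3.1: under the pinching condition
`κ_max ≤ (1+ε) κ_min + C₁(ε)` for every `ε > 0`, each normalized elementary symmetric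
function is bounded by a power of a higher one, up to an additive constant. -/
theorem stmt_7 (n k ℓ : ℕ) (hn : 2 ≤ n) (hk : 1 ≤ k) (hkl : k < ℓ) (hln : ℓ ≤ n)
    (C₁ : ℝ → ℝ) (hC₁ : ∀ ε > (0 : ℝ), 0 ≤ C₁ ε) :
    ∀ ε' > (0 : ℝ), ∃ C' ≥ (0 : ℝ),
      ∀ κ : Fin n → ℝ, (∀ i, 0 < κ i) →
        (∀ ε > (0 : ℝ), (⨆ i, κ i) ≤ (1 + ε) * (⨅ i, κ i) + C₁ ε) →
        normEsymm n k κ ≤ (1 + ε') * (normEsymm n ℓ κ) ^ ((k : ℝ) / ℓ) + C' := by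
  intro ε' hε'
  obtain ⟨ε, hε, hεk⟩ : ∃ ε : ℝ, 0 < ε ∧ (1 + 2 * ε) ^ k = 1 + ε' := by
    have hk0 : (0 : ℝ) < (k : ℝ)⁻¹ := by positivity
    have h1 : 1 < (1 + ε') ^ (k : ℝ)⁻¹ := Real.one_lt_rpow (by linarith) hk0
    refine ⟨((1 + ε') ^ (k : ℝ)⁻¹ - 1) / 2, by linarith, ?_⟩
    rw [mul_div_cancel₀ _ two_ne_zero, add_sub_cancel,
      Real.rpow_inv_natCast_pow (by linarith) (by lia)]
  have hc := hC₁ ε hε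
  refine ⟨((1 + ε) * (C₁ ε / ε) + C₁ ε) ^ k, by positivity, fun κ hκ hpinch => ?_⟩
  have ha : 0 ≤ ⨅ i, κ i := Real.iInf_nonneg fun i => (hκ i).le
  have hsup : ∀ i, κ i ≤ ⨆ i, κ i := le_ciSup (Set.finite_range κ).bddAbove
  have hinf : ∀ i, ⨅ i, κ i ≤ κ i := ciInf_le (Set.finite_range κ).bddBelow
  calc normEsymm n k κ ≤ ((1 + ε) * (⨅ i, κ i) + C₁ ε) ^ k :=
        normEsymm_le_pow (by lia) (fun i => (hκ i).le) fun i => (hsup i).trans (hpinch ε hε)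
    _ ≤ (1 + ε') * (⨅ i, κ i) ^ k + ((1 + ε) * (C₁ ε / ε) + C₁ ε) ^ k := by
        rw [← hεk]
        exact affine_pow_le k hε ha hc
    _ ≤ _ := by
        gcongr
        exact pow_le_normEsymm_rpow (by lia) hln ha hinf
end

section
/- Let n ≥ 1, α > 1 and c > 0. Let F be a real-valued function defined and differentiable on an open subset U of the n×n real matrices containing the ray {tI : t > 0}, such that: (i) F(Oᵀ A O) = F(A) for every orthogonal matrix O and every A ∈ U with Oᵀ A O ∈ U; (ii) F(tA) = t^α F(A) for every t > 0 and A ∈ U with tA ∈ U; (iii) F(I) = n^α. Then for every symmetric n×n matrix B, the Fréchet derivative of F at cI satisfies DF(cI)[B] = α·(nc)^{α−1}·tr(B). -/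
attribute [local instance] Matrix.frobeniusNormedAddCommGroup Matrix.frobeniusNormedSpace

open Matrix

/-- A linear functional on square matrices which is invariant under orthogonal conjugation is a
multiple of the trace. -/
theorem card_mul_apply_eq_trace_mul_of_orthogonal_invariant {ι : Type*} [Fintype ι] [DecidableEq ι]
    (L : Matrix ι ι ℝ →ₗ[ℝ] ℝ)
    (hL : ∀ O : Matrix ι ι ℝ, Oᵀ * O = 1 → ∀ B, L (Oᵀ * B * O) = L B) (B : Matrix ι ι ℝ) :
    (Fintype.card ι : ℝ) * L B = B.trace * L 1 := by
  have hoff (i j : ι) (hij : i ≠ j) : L (single i j 1) = 0 := by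
    let d : ι → ℝ := Function.update 1 i (-1)
    have hd : ∀ k, d k * d k = 1 := fun k => by
      by_cases hk : k = i
      · subst hk; simp [d]
      · simp [d, hk]
    have horth : (diagonal d)ᵀ * diagonal d = 1 := by
      simp [diagonal_transpose, diagonal_mul_diagonal, hd]
    have hconj : (diagonal d)ᵀ * single i j (1 : ℝ) * diagonal d = -single i j 1 := by
      ext k l
      rw [diagonal_transpose, mul_diagonal, diagonal_mul, neg_apply, single_apply]
      split_ifs with h
      · obtain ⟨rfl, rfl⟩ := h
        simp [d, hij.symm]
      · simp
    have h := hL _ horth (single i j 1)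
    rw [hconj, map_neg] at h
    linarith
  have hdiag (i j : ι) : L (single i i 1) = L (single j j 1) := by
    let P : Matrix ι ι ℝ := (Equiv.swap i j).permMatrix ℝ
    have hP : Pᵀ = P := by
      simp only [P, transpose_permMatrix, Equiv.swap_inv]
    have horth : Pᵀ * P = 1 := by
      rw [hP]
      simp only [P, ← permMatrix_mul, Equiv.swap_mul_self, permMatrix_one]
    have hconj : Pᵀ * single j j (1 : ℝ) * P = single i i 1 := by
      rw [hP]
      simp only [P, Equiv.Perm.permMatrix, PEquiv.toMatrix_toPEquiv_mul,
        PEquiv.mul_toMatrix_toPEquiv]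
      ext k l
      simp only [submatrix_apply, single_apply, id, Equiv.symm_swap, eq_comm (a := j),
        Equiv.swap_apply_eq_iff, Equiv.swap_apply_right, eq_comm (a := i)]
    rw [← hconj, hL P horth]
  have hsum (A : Matrix ι ι ℝ) (i : ι) : L A = A.trace * L (single i i 1) := by
    conv_lhs => rw [matrix_eq_sum_single A]
    rw [map_sum, trace, Finset.sum_mul]
    refine Finset.sum_congr rfl fun k _ => ?_
    have hs (l : ι) : L (single k l (A k l)) = A k l * L (single k l 1) := by
      rw [← smul_eq_mul, ← map_smul, smul_single, smul_eq_mul, mul_one]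
    rw [map_sum, Finset.sum_eq_single k, hs, hdiag k i, diag_apply]
    · intro l _ hl
      rw [hs, hoff k l hl.symm, mul_zero]
    · simp
  rcases isEmpty_or_nonempty ι with hι | ⟨⟨i⟩⟩
  · simp [trace]
  · rw [hsum B i, hsum 1 i, trace_one]
    ring

theorem hasDerivAt_comp_add_smul {E : Type*} [NormedAddCommGroup E] [NormedSpace ℝ E] {F : E → ℝ}
    {p : E} (hF : DifferentiableAt ℝ F p) (v : E) :
    HasDerivAt (fun s : ℝ => F (p + s • v)) (fderiv ℝ F p v) 0 :=
  hF.hasFDerivAt.hasLineDerivAt v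

theorem eventually_add_smul_mem {E : Type*} [NormedAddCommGroup E] [NormedSpace ℝ E] {U : Set E}
    (hU : IsOpen U) {p : E} (hp : p ∈ U) (v : E) : ∀ᶠ s : ℝ in nhds 0, p + s • v ∈ U := by
  have hcont : Continuous fun s : ℝ => p + s • v := by fun_prop
  exact hcont.continuousAt.eventually_mem (hU.mem_nhds (by simpa using hp))

/-- The derivative of an `O(n)`-invariant, degree-`α` homogeneous, normalized speed
function at a positive multiple of the identity: `DF(cI)[B] = α (nc)^{α-1} tr B` for every
symmetric `B`. This is the basis for the derivative bounds (4.2) and (4.3) of the paper. -/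
theorem stmt_9 (n : ℕ) (hn : 1 ≤ n) (α : ℝ) (hα : 1 < α) (c : ℝ) (hc : 0 < c)
    (U : Set (Matrix (Fin n) (Fin n) ℝ)) (hU : IsOpen U)
    (hray : ∀ t : ℝ, 0 < t → t • (1 : Matrix (Fin n) (Fin n) ℝ) ∈ U)
    (F : Matrix (Fin n) (Fin n) ℝ → ℝ)
    (hdiff : ∀ A ∈ U, DifferentiableAt ℝ F A)
    (hinv : ∀ O : Matrix (Fin n) (Fin n) ℝ, Oᵀ * O = 1 →
      ∀ A ∈ U, Oᵀ * A * O ∈ U → F (Oᵀ * A * O) = F A)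
    (hhomog : ∀ t : ℝ, 0 < t → ∀ A ∈ U, t • A ∈ U → F (t • A) = t ^ α * F A)
    (hnorm : F 1 = (n : ℝ) ^ α) :
    ∀ B : Matrix (Fin n) (Fin n) ℝ, Bᵀ = B →
      fderiv ℝ F (c • (1 : Matrix (Fin n) (Fin n) ℝ)) B =
        α * ((n : ℝ) * c) ^ (α - 1) * B.trace := by
  intro B _
  have hp := hray c hc
  set p : Matrix (Fin n) (Fin n) ℝ := c • 1 with hpdef
  have hFp := hdiff p hp
  have hconj (O : Matrix (Fin n) (Fin n) ℝ) (hO : Oᵀ * O = 1) (C : Matrix (Fin n) (Fin n) ℝ) :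
      fderiv ℝ F p (Oᵀ * C * O) = fderiv ℝ F p C := by
    refine (hasDerivAt_comp_add_smul hFp (Oᵀ * C * O)).unique
      ((hasDerivAt_comp_add_smul hFp C).congr_of_eventuallyEq ?_)
    filter_upwards [eventually_add_smul_mem hU hp C,
      eventually_add_smul_mem hU hp (Oᵀ * C * O)] with s h₁ h₂
    have hline : Oᵀ * (p + s • C) * O = p + s • (Oᵀ * C * O) := by
      simp [hpdef, mul_add, add_mul, hO]
    rw [← hline] at h₂ ⊢
    exact hinv O hO _ h₁ h₂
  have hone : fderiv ℝ F p 1 = α * c ^ (α - 1) * (n : ℝ) ^ α := by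
    have hpow : HasDerivAt (fun s : ℝ => (c + s) ^ α * (n : ℝ) ^ α)
        (α * c ^ (α - 1) * (n : ℝ) ^ α) 0 := by
      have h := ((hasDerivAt_id (0 : ℝ)).const_add c).rpow_const (p := α)
        (Or.inl (by simpa using hc.ne'))
      simpa using h.mul_const ((n : ℝ) ^ α)
    refine (hasDerivAt_comp_add_smul hFp 1).unique (hpow.congr_of_eventuallyEq ?_)
    filter_upwards [eventually_gt_nhds (neg_lt_zero.mpr hc)] with s hs
    have hcs : 0 < c + s := by linarith
    rw [hpdef, ← add_smul, hhomog _ hcs 1 (by simpa using hray 1 one_pos) (hray _ hcs), hnorm]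
  have hn0 : (0 : ℝ) < n := by exact_mod_cast hn
  have htrace := card_mul_apply_eq_trace_mul_of_orthogonal_invariant
    (fderiv ℝ F p).toLinearMap hconj B
  simp only [ContinuousLinearMap.coe_coe, Fintype.card_fin, hone] at htrace
  apply mul_left_cancel₀ hn0.ne'
  rw [htrace, Real.mul_rpow hn0.le hc.le, Real.rpow_sub_one hn0.ne']
  field_simp
end

section
/- Let n ≥ 2, 0 < σ₀ < 1/(n(n−1)), 0 < λ < 2 and 𝔥 > 0. For every ε > 0 there exists a constant C ≥ 0 (depending only on n, σ₀, λ, 𝔥, ε) such that: for every κ : Fin n → ℝ with H := Σᵢ κᵢ > 0 and Σᵢ (κᵢ − H/n)² ≤ min(σ₀·H², σ₀·𝔥^λ·H^{2−λ}) (real powers), one has maxᵢ κᵢ ≤ (1+ε)·minᵢ κᵢ + C. -/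
/-- A sublinear power bound on `x ^ 2` forces `|x|` to be at most any small multiple of `H`,
up to an additive constant. -/
theorem exists_abs_le_mul_add_of_sq_le_min {σ K lam δ : ℝ} (hK : 0 < K)
    (hlam : 0 < lam) (hδ : 0 < δ) :
    ∃ C ≥ (0 : ℝ), ∀ H x : ℝ, 0 < H → x ^ 2 ≤ min (σ * H ^ 2) (K * H ^ (2 - lam)) →
      |x| ≤ δ * H + C := by
  have hB : 0 < K / δ ^ 2 := by positivity
  refine ⟨√σ * (K / δ ^ 2) ^ (1 / lam), by positivity, fun H x hH hx => ?_⟩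
  obtain ⟨hx₁, hx₂⟩ := le_min_iff.mp hx
  have hC : 0 ≤ √σ * (K / δ ^ 2) ^ (1 / lam) := by positivity
  rcases le_total H ((K / δ ^ 2) ^ (1 / lam)) with h | h
  · have hx' : |x| ≤ √σ * H := by
      rw [← Real.sqrt_sq_eq_abs]
      refine (Real.sqrt_le_sqrt hx₁).trans_eq ?_
      rw [Real.sqrt_mul' _ (sq_nonneg H), Real.sqrt_sq hH.le]
    have := mul_le_mul_of_nonneg_left h (Real.sqrt_nonneg σ)
    have := mul_pos hδ hH
    linarith
  · have hpow : K / δ ^ 2 ≤ H ^ lam := by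
      have := Real.rpow_le_rpow (by positivity) h hlam.le
      rwa [← Real.rpow_mul hB.le, one_div_mul_cancel hlam.ne', Real.rpow_one] at this
    have hK' : K ≤ H ^ lam * δ ^ 2 := (div_le_iff₀ (by positivity)).mp hpow
    have hmul : H ^ lam * H ^ (2 - lam) = H ^ 2 := by
      rw [← Real.rpow_add hH, add_sub_cancel, Real.rpow_two]
    have hx' : |x| ≤ δ * H := by
      refine abs_le_of_sq_le_sq (hx₂.trans ?_) (by positivity)
      calc K * H ^ (2 - lam) ≤ H ^ lam * δ ^ 2 * H ^ (2 - lam) := by gcongr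
        _ = (δ * H) ^ 2 := by rw [mul_right_comm, hmul]; ring
    linarith


/-- Pointwise algebraic content of Corollary 10.2 of the paper: the improved pinching
estimate `‖Å‖² ≤ min{σ₀ H², σ₀ 𝔥^λ H^{2-λ}}` implies `κ_max ≤ (1+ε) κ_min + C` for
every `ε > 0`, with `C` depending only on `n, σ₀, λ, 𝔥, ε`. -/
theorem stmt_11 (n : ℕ) (hn : 2 ≤ n) (σ₀ lam 𝔥 : ℝ)
    (hσ₀ : 0 < σ₀) (hσ₀' : σ₀ < 1 / (n * (n - 1)))
    (hlam0 : 0 < lam) (hlam2 : lam < 2) (h𝔥 : 0 < 𝔥) :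
    ∀ ε > (0 : ℝ), ∃ C ≥ (0 : ℝ),
      ∀ κ : Fin n → ℝ, 0 < ∑ i, κ i →
        (∑ i, (κ i - (∑ j, κ j) / n) ^ 2 ≤
          min (σ₀ * (∑ i, κ i) ^ 2) (σ₀ * 𝔥 ^ lam * (∑ i, κ i) ^ (2 - lam))) →
        (⨆ i, κ i) ≤ (1 + ε) * (⨅ i, κ i) + C := by
  intro ε hε
  have hn0 : (0 : ℝ) < n := by exact_mod_cast (by omega : 0 < n)
  have : Nonempty (Fin n) := ⟨⟨0, by omega⟩⟩
  obtain ⟨C, hC, hbound⟩ := exists_abs_le_mul_add_of_sq_le_min (σ := σ₀)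
    (K := σ₀ * 𝔥 ^ lam) (δ := ε / (n * (2 + ε))) (by positivity) hlam0 (by positivity)
  refine ⟨(2 + ε) * C, by positivity, fun κ hH hκ => ?_⟩
  set H := ∑ i, κ i
  have hdev (i : Fin n) : |κ i - H / n| ≤ ε / (n * (2 + ε)) * H + C :=
    hbound H _ hH <| (Finset.single_le_sum (f := fun i => (κ i - H / n) ^ 2)
      (fun j _ => sq_nonneg _) (Finset.mem_univ i)).trans hκ
  have hsup : (⨆ i, κ i) ≤ H / n + (ε / (n * (2 + ε)) * H + C) :=
    ciSup_le fun i => by linarith [(abs_le.mp (hdev i)).2]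
  have hinf : H / n - (ε / (n * (2 + ε)) * H + C) ≤ ⨅ i, κ i :=
    le_ciInf fun i => by linarith [(abs_le.mp (hdev i)).1]
  have hscale : (2 + ε) * (ε / (n * (2 + ε)) * H) = ε * (H / n) := by field_simp
  have := mul_le_mul_of_nonneg_left hinf (by positivity : 0 ≤ 1 + ε)
  linarith
end

section
/- Let n ≥ 2 and α > 1. Let Γ ⊆ ℝⁿ be an open convex set contained in the positive orthant {κ : ∀i, κᵢ > 0}, closed under multiplication by positive scalars, and containing the ray {t·(1,…,1) : t > 0}. Let f : ℝⁿ → ℝ be differentiable at every point of Γ, with all partial derivatives ∂f/∂κᵢ strictly positive on Γ, positively homogeneous of degree α on Γ (f(λκ) = λ^α f(κ) for λ > 0, κ ∈ Γ), and normalized so that f(1,…,1) = n^α. Let 0 < ρ ≤ 1 and let κ ∈ Γ satisfy minᵢ κᵢ ≥ ρ·maxᵢ κᵢ. Then Σᵢ ∂f/∂κᵢ(κ)·κᵢ² ≥ α·(minᵢ κᵢ)·f(κ) ≥ (α·ρ/n)·f(κ)^{1+1/α}, where the last power is a real power (and f(κ) > 0). -/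
theorem ContinuousLinearMap.apply_eq_sum_single_one {ι : Type*} [Fintype ι] [DecidableEq ι]
    (L : (ι → ℝ) →L[ℝ] ℝ) (v : ι → ℝ) : L v = ∑ i, L (Pi.single i 1) * v i := by
  conv_lhs => rw [pi_eq_sum_univ' v]
  simp only [map_sum, map_smul, smul_eq_mul]
  exact Finset.sum_congr rfl fun i _ => mul_comm _ _

/-- A differentiable function with nonnegative partial derivatives on a convex set is monotone
on it for the coordinatewise order. -/
theorem Convex.monotoneOn_of_fderiv_single_nonneg {ι : Type*} [Fintype ι] [DecidableEq ι]
    {Γ : Set (ι → ℝ)} (hΓ : Convex ℝ Γ) {f : (ι → ℝ) → ℝ}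
    (hdiff : ∀ x ∈ Γ, DifferentiableAt ℝ f x)
    (hmono : ∀ x ∈ Γ, ∀ i, 0 ≤ fderiv ℝ f x (Pi.single i 1)) : MonotoneOn f Γ := by
  intro x hx y hy hxy
  obtain ⟨z, hz, h⟩ := domain_mvt
    (fun w hw => (hdiff w hw).hasFDerivAt.hasFDerivWithinAt) hΓ hx hy
  have hzΓ := hΓ.segment_subset hx hy hz
  rw [ContinuousLinearMap.apply_eq_sum_single_one] at h
  have : 0 ≤ ∑ i, fderiv ℝ f z (Pi.single i 1) * (y - x) i :=
    Finset.sum_nonneg fun i _ => mul_nonneg (hmono z hzΓ i) (sub_nonneg.2 (hxy i))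
  linarith

/-- Euler's relation for a function homogeneous of degree `α` along the ray through `x`. -/
theorem fderiv_apply_self_of_homogeneous {E : Type*} [NormedAddCommGroup E] [NormedSpace ℝ E]
    {f : E → ℝ} {x : E} {α : ℝ} (hf : DifferentiableAt ℝ f x)
    (hhom : ∀ t : ℝ, 0 < t → f (t • x) = t ^ α * f x) : fderiv ℝ f x x = α * f x := by
  have h₁ : HasDerivAt (fun t : ℝ => f (t • x)) (fderiv ℝ f x x) 1 := by
    have hf' : HasFDerivAt f (fderiv ℝ f x) ((1 : ℝ) • x) := by
      rw [one_smul]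
      exact hf.hasFDerivAt
    simpa [Function.comp_def] using hf'.comp_hasDerivAt (1 : ℝ) ((hasDerivAt_id (1 : ℝ)).smul_const x)
  have h₂ : HasDerivAt (fun t : ℝ => t ^ α * f x) (α * f x) 1 := by
    simpa using (Real.hasDerivAt_rpow_const (x := 1) (p := α) (Or.inl one_ne_zero)).mul_const (f x)
  refine h₁.unique (h₂.congr_of_eventuallyEq ?_)
  filter_upwards [lt_mem_nhds (zero_lt_one' ℝ)] with t ht using hhom t ht


/-- The key inequality of Section 6 (the Tso-type speed bound): for a pinched principal
curvature vector `κ` in the cone `Γ`,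
`∑ᵢ ∂ᵢf(κ) κᵢ² ≥ α κ_min f(κ) ≥ (αρ/n) f(κ)^{1+1/α}`, with `f(κ) > 0`. -/
theorem stmt_12 (n : ℕ) (hn : 2 ≤ n) (α : ℝ) (hα : 1 < α)
    (Γ : Set (Fin n → ℝ)) (hΓopen : IsOpen Γ) (hΓconv : Convex ℝ Γ)
    (hΓpos : ∀ κ ∈ Γ, ∀ i, 0 < κ i)
    (hΓcone : ∀ κ ∈ Γ, ∀ lam : ℝ, 0 < lam → lam • κ ∈ Γ)
    (hΓray : ∀ t : ℝ, 0 < t → (fun _ : Fin n => t) ∈ Γ)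
    (f : (Fin n → ℝ) → ℝ)
    (hdiff : ∀ κ ∈ Γ, DifferentiableAt ℝ f κ)
    (hmono : ∀ κ ∈ Γ, ∀ i, 0 < fderiv ℝ f κ (Pi.single i 1))
    (hhomog : ∀ lam : ℝ, 0 < lam → ∀ κ ∈ Γ, f (lam • κ) = lam ^ α * f κ)
    (hnorm : f (fun _ => 1) = (n : ℝ) ^ α)
    (ρ : ℝ) (hρ0 : 0 < ρ) (hρ1 : ρ ≤ 1)
    (κ : Fin n → ℝ) (hκ : κ ∈ Γ) (hpinch : (⨅ i, κ i) ≥ ρ * ⨆ i, κ i) :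
    0 < f κ ∧
      (∑ i, fderiv ℝ f κ (Pi.single i 1) * κ i ^ 2 ≥ α * (⨅ i, κ i) * f κ) ∧
      (α * (⨅ i, κ i) * f κ ≥ (α * ρ / n) * f κ ^ (1 + 1 / α)) := by
  have : Nonempty (Fin n) := ⟨⟨0, by omega⟩⟩
  have hn0 : (0 : ℝ) < n := by exact_mod_cast (by omega : 0 < n)
  have hα0 : 0 < α := by linarith
  have hle (i) : ⨅ i, κ i ≤ κ i := ciInf_le (Set.finite_range κ).bddBelow i
  have hge (i) : κ i ≤ ⨆ i, κ i := le_ciSup (Set.finite_range κ).bddAbove i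
  obtain ⟨j, hj⟩ := exists_eq_ciInf_of_finite (f := κ)
  have hm : 0 < ⨅ i, κ i := hj ▸ hΓpos κ hκ j
  set m := ⨅ i, κ i
  set M := ⨆ i, κ i
  have hM : 0 < M := hm.trans_le ((hle j).trans (hge j))
  have hmonoOn := hΓconv.monotoneOn_of_fderiv_single_nonneg hdiff fun x hx i => (hmono x hx i).le
  have hdiag (t : ℝ) (ht : 0 < t) : f (fun _ => t) = (n * t) ^ α := by
    have h := hhomog t ht (fun _ => 1) (hΓray 1 one_pos)
    rw [hnorm, ← Real.mul_rpow ht.le hn0.le, mul_comm t] at h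
    rw [← h]
    congr 1
    ext i
    simp
  have hlow : (n * m) ^ α ≤ f κ := hdiag m hm ▸ hmonoOn (hΓray m hm) hκ hle
  have hup : f κ ≤ (n * M) ^ α := hdiag M hM ▸ hmonoOn hκ (hΓray M hM) hge
  have hF : 0 < f κ := lt_of_lt_of_le (by positivity) hlow
  refine ⟨hF, ?_, ?_⟩
  · have hEuler := fderiv_apply_self_of_homogeneous (hdiff κ hκ) fun t ht => hhomog t ht κ hκ
    rw [ContinuousLinearMap.apply_eq_sum_single_one] at hEuler
    calc α * m * f κ = ∑ i, m * (fderiv ℝ f κ (Pi.single i 1) * κ i) := by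
          rw [← Finset.mul_sum, hEuler]
          ring
      _ ≤ ∑ i, fderiv ℝ f κ (Pi.single i 1) * κ i ^ 2 := by
          refine Finset.sum_le_sum fun i _ => ?_
          have := mul_le_mul_of_nonneg_right (hle i)
            (mul_pos (hmono κ hκ i) (hΓpos κ hκ i)).le
          linarith
  · have hroot : f κ ^ (1 / α) ≤ n * M := by
      rw [one_div]
      exact (Real.rpow_inv_le_iff_of_pos hF.le (by positivity) hα0).2 hup
    rw [Real.rpow_add hF, Real.rpow_one]
    calc α * ρ / n * (f κ * f κ ^ (1 / α)) ≤ α * ρ / n * (f κ * (n * M)) := by gcongr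
      _ = α * (ρ * M) * f κ := by field_simp
      _ ≤ α * m * f κ := by gcongr
end
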